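/- Let A and B be groups, let G̃ be a finite subgroup of A × B, and let (p,q) ∈ A × B be an element not in G̃ that normalizes G̃ and satisfies (p,q)² ∈ G̃. Let H be the subgroup generated by G̃ and (p,q), let L = pr₁(G̃) and L' = pr₁(H) be the projections to A, and let R_K = {z ∈ B : (1,z) ∈ G̃} and R'_K = {z ∈ B : (1,z) ∈ H}. If p ∉ L, then the cardinality of L' is twice the cardinality of L, and R'_K = R_K. -/

import Mathlib

/-- Adjoining to a subgroup a normalizing element whose square lies in it adds at most one coset. -/
theorem Subgroup.mem_closure_union_singleton_iff_of_sq_mem {C : Type*} [Group C] (G : Subgroup C)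
    (a : C) (hconj : ∀ g ∈ G, a⁻¹ * g * a ∈ G) (hsq : a ^ 2 ∈ G) (x : C) :
    x ∈ Subgroup.closure ((G : Set C) ∪ {a}) ↔ x ∈ G ∨ ∃ g ∈ G, a * g = x := by
  constructor
  · intro hx
    induction hx using Subgroup.closure_induction with
    | mem x hx =>
      rcases hx with hx | rfl
      · exact Or.inl hx
      · exact Or.inr ⟨1, G.one_mem, mul_one _⟩
    | one => exact Or.inl G.one_mem
    | mul x y _ _ hx hy =>
      rcases hx with hx | ⟨g, hg, rfl⟩ <;> rcases hy with hy | ⟨h, hh, rfl⟩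
      · exact Or.inl (G.mul_mem hx hy)
      · exact Or.inr ⟨_, G.mul_mem (hconj x hx) hh, by group⟩
      · exact Or.inr ⟨_, G.mul_mem hg hy, by group⟩
      · left
        convert G.mul_mem (G.mul_mem hsq (hconj g hg)) hh using 1
        group
    | inv x _ hx =>
      rcases hx with hx | ⟨g, hg, rfl⟩
      · exact Or.inl (G.inv_mem hx)
      · exact Or.inr ⟨_, G.mul_mem (hconj _ (G.inv_mem hg)) (G.inv_mem hsq), by group⟩
  · have hG : ∀ g ∈ G, g ∈ Subgroup.closure ((G : Set C) ∪ {a}) := fun g hg =>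
      Subgroup.subset_closure (Or.inl hg)
    rintro (hx | ⟨g, hg, rfl⟩)
    · exact hG x hx
    · exact Subgroup.mul_mem _ (Subgroup.subset_closure (Or.inr rfl)) (hG g hg)


/-- Let `G̃` be a finite subgroup of `A × B` and `(p, q) ∉ G̃` an element normalizing `G̃`
with `(p, q)² ∈ G̃`; let `H = ⟨G̃, (p,q)⟩`, `L = pr₁(G̃)`, `L' = pr₁(H)`,
`R_K = {z : (1,z) ∈ G̃}` and `R'_K = {z : (1,z) ∈ H}`.  If `p ∉ L`, then
`|L'| = 2 |L|` and `R'_K = R_K`. -/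
theorem index_two_extension_kernel_of_not_mem {A B : Type*} [Group A] [Group B]
    (G : Subgroup (A × B)) (hfin : (G : Set (A × B)).Finite) (p : A) (q : B)
    (hnotmem : (p, q) ∉ G)
    (hnorm : (fun x : A × B => ((p, q) : A × B)⁻¹ * x * ((p, q) : A × B)) ''
      (G : Set (A × B)) = (G : Set (A × B)))
    (hsq : ((p, q) : A × B) ^ 2 ∈ G)
    (H : Subgroup (A × B)) (hH : H = Subgroup.closure ((G : Set (A × B)) ∪ {((p, q) : A × B)}))
    (hp : p ∉ Prod.fst '' (G : Set (A × B))) :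
    (Prod.fst '' (H : Set (A × B))).ncard = 2 * (Prod.fst '' (G : Set (A × B))).ncard ∧
    {z : B | ((1 : A), z) ∈ H} = {z : B | ((1 : A), z) ∈ G} := by
  have hmem : ∀ x, x ∈ H ↔ x ∈ G ∨ ∃ g ∈ G, (p, q) * g = x := by
    rw [hH]
    exact G.mem_closure_union_singleton_iff_of_sq_mem (p, q)
      (fun g hg => hnorm.subset (Set.mem_image_of_mem _ hg)) hsq
  constructor
  · have himage : Prod.fst '' (H : Set (A × B)) =
        Prod.fst '' (G : Set (A × B)) ∪ (p * ·) '' (Prod.fst '' (G : Set (A × B))) := by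
      have hset : (H : Set (A × B)) = (G : Set (A × B)) ∪ ((p, q) * ·) '' (G : Set (A × B)) :=
        Set.ext hmem
      rw [hset, Set.image_union, Set.image_image, Set.image_image]
      rfl
    have hdisj : Disjoint (Prod.fst '' (G : Set (A × B)))
        ((p * ·) '' (Prod.fst '' (G : Set (A × B)))) := by
      rw [Set.disjoint_left]
      rintro _ ⟨g, hg, rfl⟩ ⟨_, ⟨h, hh, rfl⟩, heq⟩
      exact hp ⟨g * h⁻¹, G.mul_mem hg (G.inv_mem hh), (eq_mul_inv_of_mul_eq heq).symm⟩
    have hL := hfin.image Prod.fst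
    rw [himage, Set.ncard_union_eq hdisj hL (hL.image _),
      Set.ncard_image_of_injective _ (mul_right_injective p), two_mul]
  · ext z
    refine (hmem (1, z)).trans (or_iff_left ?_)
    rintro ⟨g, hg, heq⟩
    exact hp ⟨g⁻¹, G.inv_mem hg, (eq_inv_of_mul_eq_one_left (congrArg Prod.fst heq)).symm⟩
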